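/- DP guarantee for the noisy mean embedding (core of Theorem 1 of the paper): fix m ∈ ℕ, ε ∈ (0,1), δ ∈ (0,1), and set σ = √(2 ln(1.25/δ)) / ε. Let D = {(u_i, y_i)}_{i=1}^m and D' = {(u_i', y_i')}_{i=1}^m be two datasets with ‖u_i‖₂ ≤ 1, ‖u_i'‖₂ ≤ 1 and y_i, y_i' standard basis vectors of ℝ^k, differing in at most one index. Let μ̂_D = (1/m) Σ_i u_i y_iᵀ and μ̂_{D'} = (1/m) Σ_i u_i' y_i'ᵀ, viewed as vectors in ℝ^{dk}, and let ν_D, ν_{D'} be the Gaussian measures on ℝ^{dk} with means μ̂_D, μ̂_{D'} and covariance (4σ²/m²) I. Then for every measurable set S ⊆ ℝ^{dk}, ν_D(S) ≤ e^ε · ν_{D'}(S) + δ. -/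

import Mathlib

open MeasureTheory ProbabilityTheory
open scoped BigOperators

open scoped NNReal

/-- A product of real Gaussian measures with common nonzero variance has the product density. -/
theorem pi_gaussianReal_eq_withDensity {ι : Type*} [Fintype ι] (a : ι → ℝ) {v : ℝ≥0}
    (hv : v ≠ 0) :
    (Measure.pi fun i => gaussianReal (a i) v) =
      (volume : Measure (ι → ℝ)).withDensity
        fun x => ENNReal.ofReal (∏ i, gaussianPDFReal (a i) v (x i)) := by
  refine Measure.pi_eq fun s hs => ?_
  rw [withDensity_apply _ (MeasurableSet.univ_pi hs), volume_pi, Measure.restrict_pi_pi,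
    ← ofReal_integral_eq_lintegral_ofReal]
  · rw [integral_fintype_prod_eq_prod (fun i => gaussianPDFReal (a i) v),
      ENNReal.ofReal_prod_of_nonneg fun i _ =>
        integral_nonneg fun x => gaussianPDFReal_nonneg _ _ _]
    simp_rw [gaussianReal_apply_eq_integral _ hv]
  · exact Integrable.fintype_prod fun i => (integrable_gaussianPDFReal (a i) v).restrict
  · exact Filter.Eventually.of_forall fun x =>
      Finset.prod_nonneg fun i _ => gaussianPDFReal_nonneg _ _ _

/-- The likelihood ratio of two Gaussian densities, tilted to the power `l`, is a rescaled
Gaussian density. -/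
theorem gaussianPDFReal_mul_exp_eq (a b l x : ℝ) {v : ℝ≥0} (hv : v ≠ 0) :
    gaussianPDFReal a v x * Real.exp (l * (((x - b) ^ 2 - (x - a) ^ 2) / (2 * v))) =
      Real.exp (l * (1 + l) * ((a - b) ^ 2 / (2 * v))) *
        gaussianPDFReal (a + l * (a - b)) v x := by
  have hv' : (v : ℝ) ≠ 0 := by exact_mod_cast hv
  simp only [gaussianPDFReal]
  rw [mul_assoc, mul_left_comm (Real.exp (l * _ * _)), ← Real.exp_add, ← Real.exp_add]
  congr 2
  field_simp
  ring

theorem gaussianPDFReal_eq_mul_exp (a b x : ℝ) {v : ℝ≥0} (hv : v ≠ 0) :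
    gaussianPDFReal b v x =
      gaussianPDFReal a v x * Real.exp (-(((x - b) ^ 2 - (x - a) ^ 2) / (2 * v))) := by
  have hv' : (v : ℝ) ≠ 0 := by exact_mod_cast hv
  simp only [gaussianPDFReal]
  rw [mul_assoc _ (Real.exp _), ← Real.exp_add]
  congr 2
  field_simp
  ring

theorem one_le_exp_neg_add_exp_mul_div {l : ℝ} (hl : 0 ≤ l) (x : ℝ) :
    1 ≤ Real.exp (-x) + Real.exp (l * x) / (1 + l) := by
  have h1 : 0 < 1 + l := by linarith
  have h2 := Real.add_one_le_exp (l * x)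
  have h3 := mul_le_mul_of_nonneg_left (Real.add_one_le_exp (-x)) hl
  have h4 := Real.exp_pos (-x)
  rw [← sub_le_iff_le_add', le_div_iff₀ h1]
  nlinarith

/-- Pointwise comparison of two product Gaussian densities, with an error term proportional to a
third product Gaussian density. -/
theorem prod_gaussianPDFReal_le {ι : Type*} [Fintype ι] (a b : ι → ℝ) {v : ℝ≥0} (hv : v ≠ 0)
    (ε : ℝ) {l : ℝ} (hl : 0 ≤ l) (x : ι → ℝ) :
    ∏ i, gaussianPDFReal (a i) v (x i) ≤
      Real.exp ε * ∏ i, gaussianPDFReal (b i) v (x i) +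
        Real.exp (l * (1 + l) * ((∑ i, (a i - b i) ^ 2) / (2 * v)) - l * ε) / (1 + l) *
          ∏ i, gaussianPDFReal (a i + l * (a i - b i)) v (x i) := by
  set L : ι → ℝ := fun i => ((x i - b i) ^ 2 - (x i - a i) ^ 2) / (2 * v)
  set P := ∏ i, gaussianPDFReal (a i) v (x i) with hP
  have hP0 : 0 ≤ P := Finset.prod_nonneg fun i _ => gaussianPDFReal_nonneg _ _ _
  have hb : ∏ i, gaussianPDFReal (b i) v (x i) = P * Real.exp (-∑ i, L i) := by
    rw [← Finset.sum_neg_distrib, Real.exp_sum, hP, ← Finset.prod_mul_distrib]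
    exact Finset.prod_congr rfl fun i _ => gaussianPDFReal_eq_mul_exp _ _ _ hv
  have hc : Real.exp (l * (1 + l) * ((∑ i, (a i - b i) ^ 2) / (2 * v))) *
      ∏ i, gaussianPDFReal (a i + l * (a i - b i)) v (x i) = P * Real.exp (l * ∑ i, L i) := by
    rw [Finset.sum_div, Finset.mul_sum, Finset.mul_sum, Real.exp_sum, Real.exp_sum, hP,
      ← Finset.prod_mul_distrib, ← Finset.prod_mul_distrib]
    exact Finset.prod_congr rfl fun i _ => (gaussianPDFReal_mul_exp_eq _ _ _ _ hv).symm
  have key := mul_le_mul_of_nonneg_left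
    (one_le_exp_neg_add_exp_mul_div hl (∑ i, L i - ε)) hP0
  have e1 : Real.exp (-(∑ i, L i - ε)) = Real.exp ε * Real.exp (-∑ i, L i) := by
    rw [← Real.exp_add]; ring_nf
  have e2 : Real.exp (l * (∑ i, L i - ε)) = Real.exp (l * ∑ i, L i) * Real.exp (-(l * ε)) := by
    rw [← Real.exp_add]; ring_nf
  rw [e1, e2] at key
  rw [hb, sub_eq_add_neg, Real.exp_add]
  calc P ≤ Real.exp ε * (P * Real.exp (-∑ i, L i)) +
        (P * Real.exp (l * ∑ i, L i)) * Real.exp (-(l * ε)) / (1 + l) := by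
        linear_combination key
    _ = _ := by rw [← hc]; ring

/-- Indistinguishability of two product Gaussian measures, for every tilting parameter `l`. -/
theorem pi_gaussianReal_le {ι : Type*} [Fintype ι] (a b : ι → ℝ) {v : ℝ≥0} (hv : v ≠ 0)
    (ε : ℝ) {l : ℝ} (hl : 0 ≤ l) {S : Set (ι → ℝ)} (hS : MeasurableSet S) :
    (Measure.pi fun i => gaussianReal (a i) v) S ≤
      ENNReal.ofReal (Real.exp ε) * (Measure.pi fun i => gaussianReal (b i) v) S +
        ENNReal.ofReal
          (Real.exp (l * (1 + l) * ((∑ i, (a i - b i) ^ 2) / (2 * v)) - l * ε) / (1 + l)) := by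
  set K := Real.exp (l * (1 + l) * ((∑ i, (a i - b i) ^ 2) / (2 * v)) - l * ε) / (1 + l)
  have hK0 : 0 ≤ K := div_nonneg (Real.exp_nonneg _) (by linarith)
  have hmeas (c : ι → ℝ) :
      Measurable fun x : ι → ℝ => ENNReal.ofReal (∏ i, gaussianPDFReal (c i) v (x i)) :=
    (Finset.measurable_prod _ fun i _ =>
      (measurable_gaussianPDFReal (c i) v).comp (measurable_pi_apply i)).ennreal_ofReal
  have hle : (Measure.pi fun i => gaussianReal (a i) v) S ≤
      ENNReal.ofReal (Real.exp ε) * (Measure.pi fun i => gaussianReal (b i) v) S +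
        ENNReal.ofReal K *
          (Measure.pi fun i => gaussianReal (a i + l * (a i - b i)) v) S := by
    simp only [pi_gaussianReal_eq_withDensity _ hv]
    rw [withDensity_apply _ hS, withDensity_apply _ hS, withDensity_apply _ hS,
      ← lintegral_const_mul _ (hmeas b), ← lintegral_const_mul _ (hmeas _),
      ← lintegral_add_left ((hmeas b).const_mul _)]
    refine lintegral_mono fun x => ?_
    have hq (c : ι → ℝ) : 0 ≤ ∏ i, gaussianPDFReal (c i) v (x i) :=
      Finset.prod_nonneg fun i _ => gaussianPDFReal_nonneg _ _ _
    rw [← ENNReal.ofReal_mul (Real.exp_nonneg _), ← ENNReal.ofReal_mul hK0,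
      ← ENNReal.ofReal_add (mul_nonneg (Real.exp_nonneg _) (hq _)) (mul_nonneg hK0 (hq _))]
    exact ENNReal.ofReal_le_ofReal (prod_gaussianPDFReal_le a b hv ε hl x)
  refine hle.trans (add_le_add_right ?_ _)
  exact mul_le_of_le_one_right' prob_le_one

/-- The Gaussian mechanism: two product Gaussian measures with standard deviation at least
`√(2 ln(1.25/δ))/ε` times the distance of their means are `(ε, δ)`-indistinguishable. -/
theorem gaussian_mechanism {ι : Type*} [Fintype ι] (a b : ι → ℝ) {v : ℝ≥0} (hv : v ≠ 0)
    {ε δ : ℝ} (hε0 : 0 < ε) (hε1 : ε < 1) (hδ0 : 0 < δ) (hδ1 : δ < 1)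
    (hab : 2 * Real.log (1.25 / δ) * ∑ i, (a i - b i) ^ 2 ≤ ε ^ 2 * v)
    {S : Set (ι → ℝ)} (hS : MeasurableSet S) :
    (Measure.pi fun i => gaussianReal (a i) v) S ≤
      ENNReal.ofReal (Real.exp ε) * (Measure.pi fun i => gaussianReal (b i) v) S +
        ENNReal.ofReal δ := by
  have hv' : (0 : ℝ) < v := by exact_mod_cast pos_iff_ne_zero.mpr hv
  set t := Real.log (1.25 / δ) with ht
  have hr : 1.25 < 1.25 / δ := by rw [lt_div_iff₀ hδ0]; linarith
  have ht1 : 0.2 ≤ t := by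
    have h1 := Real.one_sub_inv_le_log_of_pos (show (0 : ℝ) < 1.25 by norm_num)
    have h2 := Real.log_le_log (by norm_num) hr.le
    norm_num at h1 h2 ⊢
    linarith
  have hl : 0 ≤ 2 * t / ε := by positivity
  have htl : 0.4 ≤ 2 * t / ε := by
    rw [le_div_iff₀ hε0]; nlinarith
  refine (pi_gaussianReal_le a b hv ε hl hS).trans
    (add_le_add_right (ENNReal.ofReal_le_ofReal ?_) _)
  rw [div_le_iff₀ (by linarith)]
  have hexp : 2 * t / ε * (1 + 2 * t / ε) * ((∑ i, (a i - b i) ^ 2) / (2 * v)) - 2 * t / ε * ε ≤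
      1 / 2 + -t := by
    have h1 : 2 * t * ((∑ i, (a i - b i) ^ 2) / (2 * v)) ≤ ε ^ 2 / 2 := by
      rw [← mul_div_assoc, div_le_iff₀ (by positivity)]; linarith
    have h2 := mul_le_mul_of_nonneg_left h1 (show 0 ≤ (1 + 2 * t / ε) / ε by positivity)
    have h3 : (1 + 2 * t / ε) / ε * (ε ^ 2 / 2) = ε / 2 + t := by field_simp
    have h4 : 2 * t / ε * ε = 2 * t := by field_simp
    have h5 : 2 * t / ε * (1 + 2 * t / ε) * ((∑ i, (a i - b i) ^ 2) / (2 * v)) =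
      (1 + 2 * t / ε) / ε * (2 * t * ((∑ i, (a i - b i) ^ 2) / (2 * v))) := by ring
    rw [h5, h4]
    linarith
  have hexpt : Real.exp (-t) = δ / 1.25 := by
    rw [ht, Real.exp_neg, Real.exp_log (by positivity), inv_div]
  have hhalf : Real.exp (1 / 2) ≤ 1.75 := by
    have h1 : Real.exp (1 / 2) ^ 2 = Real.exp 1 := by
      rw [← Real.exp_nat_mul]; norm_num
    nlinarith [Real.exp_one_lt_d9, Real.exp_pos (1 / 2)]
  calc _ ≤ Real.exp (1 / 2 + -t) := Real.exp_le_exp.mpr hexp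
    _ = Real.exp (1 / 2) * (δ / 1.25) := by rw [Real.exp_add, hexpt]
    _ ≤ 1.75 * (δ / 1.25) := by gcongr
    _ = δ * (1 + 0.4) := by ring
    _ ≤ _ := by gcongr

theorem sum_sq_outer_sub_outer_le {ι κ : Type*} [Fintype ι] [Fintype κ]
    {u u' : EuclideanSpace ℝ ι} {y y' : EuclideanSpace ℝ κ}
    (hu : ‖u‖ ≤ 1) (hu' : ‖u'‖ ≤ 1) (hy : ‖y‖ ≤ 1) (hy' : ‖y'‖ ≤ 1) :
    ∑ p : ι × κ, (u p.1 * y p.2 - u' p.1 * y' p.2) ^ 2 ≤ 4 := by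
  have hnorm (w : EuclideanSpace ℝ ι) (z : EuclideanSpace ℝ κ) (hw : ‖w‖ ≤ 1) (hz : ‖z‖ ≤ 1) :
      ∑ p : ι × κ, (w p.1 * z p.2) ^ 2 ≤ 1 := by
    simp_rw [mul_pow]
    rw [Fintype.sum_prod_type]
    simp only
    rw [← Finset.sum_mul_sum, ← EuclideanSpace.real_norm_sq_eq,
      ← EuclideanSpace.real_norm_sq_eq, ← mul_pow]
    exact pow_le_one₀ (by positivity) (mul_le_one₀ hw (norm_nonneg _) hz)
  calc _ ≤ ∑ p : ι × κ, (2 * (u p.1 * y p.2) ^ 2 + 2 * (u' p.1 * y' p.2) ^ 2) :=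
        Finset.sum_le_sum fun p _ => by nlinarith [sq_nonneg (u p.1 * y p.2 + u' p.1 * y' p.2)]
    _ ≤ 4 := by
        rw [Finset.sum_add_distrib, ← Finset.mul_sum, ← Finset.mul_sum]
        linarith [hnorm u y hu hy, hnorm u' y' hu' hy']

/-- DP guarantee for the noisy mean embedding (core of Theorem 1 of the paper):
with `σ = √(2 ln(1.25/δ))/ε`, for neighboring datasets (unit-bounded features,
one-hot labels, differing in at most one index), the Gaussian measures on `ℝ^{dk}`
centered at the mean embeddings with covariance `(4σ²/m²) I` are
`(ε, δ)`-indistinguishable. -/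
theorem noisy_mean_embedding_dp (d k m : ℕ) (hm : 0 < m)
    (ε δ : ℝ) (hε0 : 0 < ε) (hε1 : ε < 1) (hδ0 : 0 < δ) (hδ1 : δ < 1)
    (σ : ℝ) (hσ : σ = Real.sqrt (2 * Real.log (1.25 / δ)) / ε)
    (u u' : Fin m → EuclideanSpace ℝ (Fin d))
    (y y' : Fin m → EuclideanSpace ℝ (Fin k))
    (hu : ∀ i, ‖u i‖ ≤ 1) (hu' : ∀ i, ‖u' i‖ ≤ 1)
    (hy : ∀ i, ∃ l : Fin k, y i = EuclideanSpace.single l (1 : ℝ))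
    (hy' : ∀ i, ∃ l : Fin k, y' i = EuclideanSpace.single l (1 : ℝ))
    (hdiff : ∃ j : Fin m, ∀ i, i ≠ j → u i = u' i ∧ y i = y' i) :
    ∀ S : Set (Fin d × Fin k → ℝ), MeasurableSet S →
      (Measure.pi fun p : Fin d × Fin k =>
          gaussianReal ((1 / (m : ℝ)) * ∑ i : Fin m, u i p.1 * y i p.2)
            (Real.toNNReal (4 * σ ^ 2 / (m : ℝ) ^ 2))) S
        ≤ ENNReal.ofReal (Real.exp ε) *
            (Measure.pi fun p : Fin d × Fin k =>
              gaussianReal ((1 / (m : ℝ)) * ∑ i : Fin m, u' i p.1 * y' i p.2)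
                (Real.toNNReal (4 * σ ^ 2 / (m : ℝ) ^ 2))) S
          + ENNReal.ofReal δ := by
  intro S hS
  obtain ⟨j, hj⟩ := hdiff
  have hm' : (0 : ℝ) < m := by exact_mod_cast hm
  have hlog : 0 < Real.log (1.25 / δ) :=
    Real.log_pos (by rw [lt_div_iff₀ hδ0]; linarith)
  have hσ2 : σ ^ 2 = 2 * Real.log (1.25 / δ) / ε ^ 2 := by
    rw [hσ, div_pow, Real.sq_sqrt (by positivity)]
  have hvar : 0 < 4 * σ ^ 2 / (m : ℝ) ^ 2 := by rw [hσ2]; positivity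
  have hy1 : ‖y j‖ ≤ 1 := by obtain ⟨l, h⟩ := hy j; simp [h]
  have hy1' : ‖y' j‖ ≤ 1 := by obtain ⟨l, h⟩ := hy' j; simp [h]
  have hdist (p : Fin d × Fin k) :
      (1 / (m : ℝ)) * ∑ i, u i p.1 * y i p.2 - (1 / (m : ℝ)) * ∑ i, u' i p.1 * y' i p.2 =
        (1 / (m : ℝ)) * (u j p.1 * y j p.2 - u' j p.1 * y' j p.2) := by
    rw [← mul_sub, ← Finset.sum_sub_distrib, Finset.sum_eq_single j]
    · intro i _ hi
      rw [(hj i hi).1, (hj i hi).2, sub_self]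
    · simp
  refine gaussian_mechanism _ _ (Real.toNNReal_pos.mpr hvar).ne' hε0 hε1 hδ0 hδ1 ?_ hS
  rw [Real.coe_toNNReal _ hvar.le, hσ2]
  simp_rw [hdist, mul_pow]
  rw [← Finset.mul_sum]
  have hsum := sum_sq_outer_sub_outer_le (hu j) (hu' j) hy1 hy1'
  calc _ ≤ 2 * Real.log (1.25 / δ) * ((1 / (m : ℝ)) ^ 2 * 4) := by gcongr
    _ = _ := by field_simp
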